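/- Let m be an even positive integer, let b ≥ 1, c be integers with t = b·c, and let q ≥ 1. Let x, y : ℤ/(m+1)ℤ → ℤ, define z by z_i = ∑_{j=1}^{m/2} (x_{h−j} − x_{h+j})·(y_{h+j} − y_{h−j}) (where 2h = i in ℤ/(m+1)ℤ), and let w be the result of applying q times to z the map v ↦ v' with v'_i = ⌊v_i/b⌋ + c·(v_{i+1} mod b). Then b^q·∑_{i=0}^{m} w_i·t^i ≡ (∑_{i=0}^{m} x_i·t^i)·(∑_{i=0}^{m} y_i·t^i) (mod ∑_{i=0}^{m} t^i). -/

import Mathlib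

open Finset

/-- The value at `t` of the vector `v` of coefficients indexed by `ZMod (m + 1)`. -/
def evalVec {R : Type*} [CommRing R] {m : ℕ} (t : R) (v : ZMod (m + 1) → ℤ) : R :=
  ∑ i, (v i : R) * t ^ i.val

lemma ZMod.sum_univ_eq_sum_range {M : Type*} [AddCommMonoid M] (m : ℕ)
    (f : ZMod (m + 1) → ℕ → M) :
    ∑ i, f i i.val = ∑ i ∈ range (m + 1), f (i : ZMod (m + 1)) i := by
  rw [Finset.sum_range]
  refine Fintype.sum_congr (α := Fin (m + 1)) _ _ fun i => ?_
  have hi : ((i.val : ℕ) : ZMod (m + 1)) = i := ZMod.natCast_zmod_val (n := m + 1) i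
  rw [hi]
  rfl

lemma ZMod.sum_univ_eq_zero_add_sum_pairs {M : Type*} [AddCommMonoid M] (n : ℕ)
    (g : ZMod (n + n + 1) → M) :
    ∑ k, g k = g 0 + ∑ j ∈ Icc 1 n, (g j + g (-j)) := by
  rw [ZMod.sum_univ_eq_sum_range (n + n) fun k _ => g k, sum_range_succ', sum_range_add,
    ← sum_range_reflect (fun j => g ((n + j + 1 : ℕ) : ZMod (n + n + 1))), ← sum_add_distrib,
    add_comm, Nat.cast_zero, ← Ico_add_one_right_eq_Icc, sum_Ico_eq_sum_range, Nat.add_sub_cancel]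
  congr 1
  refine sum_congr rfl fun j hj => ?_
  have hjn := mem_range.1 hj
  have hneg : ((n + (n - 1 - j) + 1 : ℕ) : ZMod (n + n + 1)) = -((1 + j : ℕ) : ZMod (n + n + 1)) := by
    rw [eq_neg_iff_add_eq_zero, ← Nat.cast_add,
      show n + (n - 1 - j) + 1 + (1 + j) = n + n + 1 by omega, ZMod.natCast_self]
  rw [hneg, add_comm j 1]

lemma pow_val_add {R : Type*} [CommRing R] {m : ℕ} {t : R} (ht : t ^ (m + 1) = 1)
    (i j : ZMod (m + 1)) : t ^ (i + j).val = t ^ i.val * t ^ j.val := by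
  rw [ZMod.val_add, ← pow_add, ← pow_mod_orderOf,
    Nat.mod_mod_of_dvd _ (orderOf_dvd_of_pow_eq_one ht), pow_mod_orderOf]

lemma evalVec_mul {R : Type*} [CommRing R] {m : ℕ} {t : R} (ht : t ^ (m + 1) = 1)
    (x y : ZMod (m + 1) → ℤ) :
    evalVec t x * evalVec t y = evalVec t fun i => ∑ k, x k * y (i - k) := by
  simp only [evalVec, Int.cast_sum, sum_mul]
  rw [sum_comm (s := univ) (t := univ) (f := fun i k => ((x k * y (i - k) : ℤ) : R) * t ^ i.val)]
  refine Fintype.sum_congr _ _ fun k => ?_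
  rw [mul_sum, ← Equiv.sum_comp (Equiv.addRight k)
    fun i => ((x k * y (i - k) : ℤ) : R) * t ^ i.val]
  refine Fintype.sum_congr _ _ fun i => ?_
  rw [Equiv.coe_addRight, add_sub_cancel_right, pow_val_add ht]
  push_cast
  ring

lemma evalVec_sub_const {R : Type*} [CommRing R] {m : ℕ} {t : R}
    (ht : ∑ i ∈ range (m + 1), t ^ i = 0) (v : ZMod (m + 1) → ℤ) (a : ℤ) :
    evalVec t (fun i => v i - a) = evalVec t v := by
  simp only [evalVec, Int.cast_sub, sub_mul, sum_sub_distrib, ← mul_sum]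
  rw [ZMod.sum_univ_eq_sum_range m fun _ i => t ^ i, ht, mul_zero, sub_zero]

/-- The cyclic vector multiplication formula is the cyclic convolution up to a constant vector. -/
lemma cvma_eq_convolution_sub (n : ℕ) (x y : ZMod (n + n + 1) → ℤ) (h i : ZMod (n + n + 1))
    (hi : 2 * h = i) :
    ∑ j ∈ Icc 1 n, (x (h - (j : ZMod (n + n + 1))) - x (h + (j : ZMod (n + n + 1)))) *
        (y (h + (j : ZMod (n + n + 1))) - y (h - (j : ZMod (n + n + 1)))) =
      ∑ k, x k * y (i - k) - ∑ k, x k * y k := by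
  rw [← sum_sub_distrib, ← Equiv.sum_comp (Equiv.subLeft h), ZMod.sum_univ_eq_zero_add_sum_pairs]
  have hsub (k : ZMod (n + n + 1)) : i - (h - k) = h + k := by rw [← hi]; ring
  simp only [Equiv.subLeft_apply, hsub]
  simp only [sub_zero, add_zero, sub_self, zero_add, sub_neg_eq_add, ← sub_eq_add_neg]
  exact sum_congr rfl fun j _ => by ring

/-- One reduction step divides the represented value by `b`. -/
lemma mul_evalVec_step {R : Type*} [CommRing R] {m : ℕ} {t : R} (ht : t ^ (m + 1) = 1)
    (b c : ℤ) (hbc : t = b * c) (v : ZMod (m + 1) → ℤ) :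
    b * evalVec t (fun i => v i / b + c * (v (i + 1) % b)) = evalVec t v := by
  have hshift : t * evalVec t (fun i => v (i + 1) % b) = evalVec t fun i => v i % b := by
    rw [evalVec, evalVec, ← Equiv.sum_comp (Equiv.addRight (1 : ZMod (m + 1)))
      fun i => ((v i % b : ℤ) : R) * t ^ i.val, mul_sum]
    refine Fintype.sum_congr _ _ fun i => ?_
    have hone : t ^ (1 : ZMod (m + 1)).val = t := by
      rw [ZMod.val_one_eq_one_mod, ← pow_mod_orderOf,
        Nat.mod_mod_of_dvd _ (orderOf_dvd_of_pow_eq_one ht), pow_mod_orderOf, pow_one]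
    rw [Equiv.coe_addRight, pow_val_add ht, hone]
    ring
  have hdiv : evalVec t v = b * evalVec t (fun i => v i / b) + evalVec t fun i => v i % b := by
    simp only [evalVec, mul_sum, ← sum_add_distrib]
    refine Fintype.sum_congr _ _ fun i => ?_
    conv_lhs => rw [← Int.mul_ediv_add_emod (v i) b]
    push_cast
    ring
  rw [hdiv, ← hshift, hbc]
  simp only [evalVec, mul_sum, ← sum_add_distrib]
  refine Fintype.sum_congr _ _ fun i => ?_
  push_cast
  ring

lemma pow_mul_evalVec_iterate {R : Type*} [CommRing R] {m : ℕ} {t : R} (ht : t ^ (m + 1) = 1)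
    (b c : ℤ) (hbc : t = b * c) (q : ℕ) (v : ZMod (m + 1) → ℤ) :
    b ^ q * evalVec t ((fun (v : ZMod (m + 1) → ℤ) (i : ZMod (m + 1)) =>
      v i / b + c * (v (i + 1) % b))^[q] v) = evalVec t v := by
  induction q with
  | zero => simp
  | succ q ih => rw [Function.iterate_succ_apply', pow_succ, mul_assoc,
      mul_evalVec_step ht b c hbc, ih]

/-- Correctness of the full GRP modular multiplication algorithm: with `t = b·c`,
`z` the CVMA product of `x` and `y`, and `w` the result of applying `q` reduction steps
`v'_i = ⌊v_i/b⌋ + c·(v_{i+1} mod b)` to `z`, one has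
`b^q·∑ w_i t^i ≡ (∑ x_i t^i)(∑ y_i t^i) (mod ∑_{i=0}^m t^i)`. -/
theorem grp_modmul_correct (m : ℕ) (hm : 0 < m) (hme : Even m)
    (b c : ℤ) (hb : 1 ≤ b) (t : ℤ) (ht : t = b * c) (q : ℕ) (hq : 1 ≤ q)
    (x y z : ZMod (m + 1) → ℤ) (h : ZMod (m + 1) → ZMod (m + 1))
    (hh : ∀ i, 2 * h i = i)
    (hz : ∀ i, z i = ∑ j ∈ Finset.Icc 1 (m / 2),
        (x (h i - (j : ZMod (m + 1))) - x (h i + (j : ZMod (m + 1)))) *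
          (y (h i + (j : ZMod (m + 1))) - y (h i - (j : ZMod (m + 1)))))
    (w : ZMod (m + 1) → ℤ)
    (hw : w = (fun (v : ZMod (m + 1) → ℤ) (i : ZMod (m + 1)) =>
        v i / b + c * (v (i + 1) % b))^[q] z) :
    b ^ q * ∑ i ∈ Finset.range (m + 1), w (i : ZMod (m + 1)) * t ^ i ≡
      (∑ i ∈ Finset.range (m + 1), x (i : ZMod (m + 1)) * t ^ i) *
        (∑ i ∈ Finset.range (m + 1), y (i : ZMod (m + 1)) * t ^ i)
      [ZMOD ∑ i ∈ Finset.range (m + 1), t ^ i] := by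
  obtain ⟨n, rfl⟩ := hme
  have hn : (n + n) / 2 = n := by omega
  set N : ℤ := ∑ i ∈ range (n + n + 1), t ^ i with hN
  let φ := Ideal.Quotient.mk (Ideal.span {N})
  have hsum : ∑ i ∈ range (n + n + 1), φ t ^ i = 0 := by
    simp only [← map_pow, ← map_sum]
    exact Ideal.Quotient.eq_zero_iff_mem.2 (Ideal.mem_span_singleton_self N)
  have hpow : φ t ^ (n + n + 1) = 1 := by
    rw [← sub_eq_zero, ← geom_sum_mul, hsum, zero_mul]
  have hbc : φ t = b * c := by rw [ht, map_mul, eq_intCast, eq_intCast]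
  have hφ (v : ZMod (n + n + 1) → ℤ) :
      φ (∑ i ∈ range (n + n + 1), v (i : ZMod (n + n + 1)) * t ^ i) = evalVec (φ t) v := by
    rw [evalVec, ZMod.sum_univ_eq_sum_range (n + n) fun k i => (v k : ℤ ⧸ Ideal.span {N}) * φ t ^ i,
      map_sum]
    exact sum_congr rfl fun i _ => by rw [map_mul, map_pow, eq_intCast φ (v i)]
  have hzx : z = fun i => ∑ k, x k * y (i - k) - ∑ k, x k * y k := by
    funext i
    rw [hz i, hn, cvma_eq_convolution_sub n x y (h i) i (hh i)]
  rw [Int.modEq_comm, Int.modEq_iff_dvd, ← Ideal.mem_span_singleton, ← Ideal.Quotient.eq_zero_iff_mem,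
    map_sub, sub_eq_zero]
  change φ _ = φ _
  rw [map_mul, map_mul, hφ, hφ, hφ, map_pow, eq_intCast φ b, hw, pow_mul_evalVec_iterate hpow b c hbc,
    hzx, evalVec_sub_const hsum, evalVec_mul hpow]
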